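/- Let J be a countable index set, let (r_j)_{j∈J} be pairwise distinct elements of [0,∞) and let (x_j)_{j∈J} be nonnegative reals with ∑_{j∈J} x_j < +∞. Then for every r ≥ 0 one has 1 − exp(−∑_{j∈J} 1_{{r_j ≥ r}} x_j) = ∑_{j∈J} 1_{{r_j ≥ r}} (1 − e^{−x_j}) · exp(−∑_{ℓ∈J} 1_{{r_ℓ > r_j}} x_ℓ), where the sums are (countable) sums of nonnegative terms. -/

import Mathlib

/-- Telescoping: insert the indices one at a time, in decreasing order of their locations. -/
theorem one_sub_exp_neg_finset_sum {J α : Type*} [LinearOrder α] {r : J → α}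
    (hr : Function.Injective r) (y : J → ℝ) (s : Finset J) :
    1 - Real.exp (-∑ j ∈ s, y j) =
      ∑ j ∈ s, (1 - Real.exp (-y j)) *
        Real.exp (-∑ l ∈ s, if r j < r l then y l else 0) := by
  classical
  induction s using Finset.induction_on_min_value r with
  | empty => simp
  | insert a s ha hmin ih =>
    have hlt : ∀ j ∈ s, r a < r j := fun j hj =>
      (hmin j hj).lt_of_ne fun h => ha (hr h ▸ hj)
    have htop : ∑ l ∈ s, (if r a < r l then y l else 0) = ∑ l ∈ s, y l :=
      Finset.sum_congr rfl fun l hl => if_pos (hlt l hl)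
    have hrest : ∀ j ∈ s, (1 - Real.exp (-y j)) *
          Real.exp (-∑ l ∈ insert a s, if r j < r l then y l else 0) =
        (1 - Real.exp (-y j)) * Real.exp (-∑ l ∈ s, if r j < r l then y l else 0) := by
      intro j hj
      rw [Finset.sum_insert ha, if_neg (hlt j hj).not_gt, zero_add]
    rw [Finset.sum_insert ha, Finset.sum_insert ha, Finset.sum_insert ha,
      Finset.sum_congr rfl hrest, ← ih, htop, if_neg (lt_irrefl _), zero_add, neg_add,
      Real.exp_add]
    ring

open Filter Topology in
theorem Summable.tendsto_exp_neg_sum {J : Type*} {f : J → ℝ} (hf : Summable f) :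
    Tendsto (fun s : Finset J => Real.exp (-∑ j ∈ s, f j)) atTop
      (𝓝 (Real.exp (-∑' j, f j))) := by
  have h : Tendsto (fun s : Finset J => ∑ j ∈ s, f j) atTop (𝓝 (∑' j, f j)) := hf.hasSum
  exact (Real.continuous_exp.tendsto _).comp h.neg

open Filter Topology in
/-- The countable version of `one_sub_exp_neg_finset_sum`, by dominated convergence. -/
theorem one_sub_exp_neg_tsum {J α : Type*} [LinearOrder α] {r : J → α}
    (hr : Function.Injective r) {y : J → ℝ} (hy : ∀ j, 0 ≤ y j) (hsum : Summable y) :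
    1 - Real.exp (-∑' j, y j) =
      ∑' j, (1 - Real.exp (-y j)) * Real.exp (-∑' l, if r j < r l then y l else 0) := by
  classical
  have hite : ∀ j l, 0 ≤ if r j < r l then y l else 0 := fun j l => by
    split_ifs <;> simp [hy]
  have hsum' : ∀ j, Summable fun l => if r j < r l then y l else 0 := fun j =>
    hsum.of_nonneg_of_le (hite j) fun l => by split_ifs <;> simp [hy]
  let F : Finset J → J → ℝ := fun s j => if j ∈ s then
    (1 - Real.exp (-y j)) * Real.exp (-∑ l ∈ s, if r j < r l then y l else 0) else 0
  have hF : ∀ s, ∑' j, F s j = 1 - Real.exp (-∑ j ∈ s, y j) := fun s => by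
    rw [one_sub_exp_neg_finset_sum hr, tsum_eq_sum (s := s) fun j hj => if_neg hj]
    exact Finset.sum_congr rfl fun j hj => if_pos hj
  have hlim : Tendsto (fun s => ∑' j, F s j) atTop
      (𝓝 (∑' j, (1 - Real.exp (-y j)) *
        Real.exp (-∑' l, if r j < r l then y l else 0))) := by
    refine tendsto_tsum_of_dominated_convergence hsum (fun j => ?_) (.of_forall fun s j => ?_)
    · refine ((hsum' j).tendsto_exp_neg_sum.const_mul (1 - Real.exp (-y j))).congr' ?_
      filter_upwards [eventually_ge_atTop {j}] with s hs
      exact (if_pos (Finset.singleton_subset_iff.mp hs)).symm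
    · by_cases hj : j ∈ s
      · have h0 : 0 ≤ 1 - Real.exp (-y j) := by simp [hy]
        have h1 : 1 - Real.exp (-y j) ≤ y j := by linarith [Real.add_one_le_exp (-y j)]
        have h2 : Real.exp (-∑ l ∈ s, if r j < r l then y l else 0) ≤ 1 :=
          Real.exp_le_one_iff.mpr (neg_nonpos.mpr (Finset.sum_nonneg fun l _ => hite j l))
        simp only [F, if_pos hj]
        rw [Real.norm_of_nonneg (mul_nonneg h0 (Real.exp_nonneg _))]
        exact (mul_le_of_le_one_right h0 h2).trans h1
      · simp [F, hj, hy]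
  simp only [hF] at hlim
  exact tendsto_nhds_unique (hsum.tendsto_exp_neg_sum.const_sub 1) hlim


/-- Lemma 4.1: atom-by-atom decomposition of an exponential functional of a point
measure on `[0,∞)` with pairwise distinct locations and summable weights. -/
theorem record_forest_stmt0 {J : Type*} [Countable J] (r x : J → ℝ)
    (hr : ∀ j, 0 ≤ r j) (hrdist : Function.Injective r)
    (hx : ∀ j, 0 ≤ x j) (hsum : Summable x) :
    ∀ q : ℝ, 0 ≤ q →
      1 - Real.exp (-(∑' j, if q ≤ r j then x j else 0)) =
        ∑' j, (if q ≤ r j then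
          (1 - Real.exp (-(x j))) * Real.exp (-(∑' l, if r j < r l then x l else 0))
        else 0) := by
  intro q _
  have hite : ∀ j, 0 ≤ if q ≤ r j then x j else 0 := fun j => by
    split_ifs <;> simp [hx]
  rw [one_sub_exp_neg_tsum hrdist hite
    (hsum.of_nonneg_of_le hite fun j => by split_ifs <;> simp [hx])]
  refine tsum_congr fun j => ?_
  split_ifs with hj
  · congr 3
    refine tsum_congr fun l => ?_
    split_ifs with h1 h2
    · rfl
    · exact absurd (hj.trans h1.le) h2
    · rfl
  · simp
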